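/- Let G be a finite simple graph on a finite vertex set V and let A, B be distinct vertices. Define T(H)(X) = Σ_{J ⊆ V} (−1)^{|J|} X^{d_J(H)} ∈ ℤ[X] for a graph H on V, where d_J(H) ∈ {0,1} is the natural-number value of the determinant over ℤ/2ℤ of adj_J(H). Then T satisfies the 4-term relation: T(G) − T(G'_{AB}) − T(G̃_{AB}) + T(G̃'_{AB}) = 0. -/

import Mathlib

open Matrix Polynomial

/-- The graph obtained from `G` by toggling (adding if absent, deleting if present)
the edge `{A, B}`. -/
def toggleEdge {V : Type*} (G : SimpleGraph V) (A B : V) : SimpleGraph V :=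
  SimpleGraph.fromEdgeSet (symmDiff G.edgeSet {s(A, B)})

/-- The graph `G̃_{AB}`: toggle the edge `{A, C}` for every vertex `C ∉ {A, B}`
that is adjacent to `B` in `G`; all other adjacencies are unchanged. -/
def gTilde {V : Type*} (G : SimpleGraph V) (A B : V) : SimpleGraph V :=
  SimpleGraph.fromEdgeSet (symmDiff G.edgeSet
    {e | ∃ C, C ≠ A ∧ C ≠ B ∧ G.Adj B C ∧ e = s(A, C)})

open Classical in
/-- The adjacency matrix over `ℤ/2ℤ` of the marked graph `(G, J)`: off-diagonal
entry `(i,j)` is `1` iff `i` and `j` are adjacent, and diagonal entry `(i,i)` is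
`1` iff `i ∈ J`. -/
noncomputable def markedAdj {V : Type*} (G : SimpleGraph V) (J : Finset V) :
    Matrix V V (ZMod 2) :=
  Matrix.of fun i j =>
    if i = j then (if i ∈ J then 1 else 0) else (if G.Adj i j then 1 else 0)

/-- `T(G)(X) = Σ_{J ⊆ V} (−1)^{|J|} X^{d_J(G)} ∈ ℤ[X]`, where `d_J(G) ∈ {0,1}` is the natural-number value of the determinant over `ℤ/2ℤ` of `adj_J(G)`. -/
noncomputable def polyT {V : Type*} [Fintype V] [DecidableEq V] (G : SimpleGraph V) :
    Polynomial ℤ :=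
  ∑ J : Finset V, (-1 : Polynomial ℤ) ^ J.card * Polynomial.X ^ ((markedAdj G J).det).val

theorem toggleEdge_adj {V : Type*} (G : SimpleGraph V) {A B : V} (hAB : A ≠ B) (i j : V) :
    (toggleEdge G A B).Adj i j ↔
      Xor (G.Adj i j) ((i = A ∧ j = B) ∨ (i = B ∧ j = A)) := by
  have := G.ne_of_adj (a := i) (b := j)
  simp only [toggleEdge, SimpleGraph.fromEdgeSet_adj, Set.mem_symmDiff,
    SimpleGraph.mem_edgeSet, Set.mem_singleton_iff, Sym2.eq_iff, Xor]
  grind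

theorem gTilde_adj {V : Type*} (G : SimpleGraph V) (A B i j : V) :
    (gTilde G A B).Adj i j ↔
      Xor (G.Adj i j) ((i = A ∧ j ≠ A ∧ j ≠ B ∧ G.Adj B j) ∨
        (j = A ∧ i ≠ A ∧ i ≠ B ∧ G.Adj B i)) := by
  have := G.ne_of_adj (a := i) (b := j)
  simp only [gTilde, SimpleGraph.fromEdgeSet_adj, Set.mem_symmDiff,
    SimpleGraph.mem_edgeSet, Set.mem_ofPred_eq, Sym2.eq_iff, Xor]
  grind

theorem toggleEdge_toggleEdge {V : Type*} (G : SimpleGraph V) {A B : V} (hAB : A ≠ B) :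
    toggleEdge (toggleEdge G A B) A B = G := by
  ext i j
  simp only [toggleEdge_adj _ hAB, Xor]
  tauto

theorem gTilde_toggleEdge {V : Type*} (G : SimpleGraph V) {A B : V} (hAB : A ≠ B) :
    gTilde (toggleEdge G A B) A B = toggleEdge (gTilde G A B) A B := by
  ext i j
  simp only [toggleEdge_adj _ hAB, gTilde_adj, Xor]
  grind

/-- Adding row `b` to row `a` and then column `b` to column `a` preserves the determinant. -/
theorem det_eq_of_add_row_col {V R : Type*} [Fintype V] [DecidableEq V] [CommRing R]
    {M N : Matrix V V R} {a b : V} (hab : a ≠ b)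
    (h : ∀ i j, N i j = M i j + (if i = a then M b j else 0) +
      (if j = a then M i b + (if i = a then M b b else 0) else 0)) :
    M.det = N.det := by
  have hN : N = transvection a b 1 * M * transvection b a 1 := by
    ext i j
    have row : ∀ k, (transvection a b (1 : R) * M) i k =
        M i k + if i = a then M b k else 0 := by
      intro k
      by_cases hi : i = a
      · subst hi; simp
      · simp [hi]
    by_cases hj : j = a
    · subst hj; simp [h, row]
    · simp [h, row, hj]
  rw [hN, det_mul, det_mul, det_transvection_of_ne _ _ hab, det_transvection_of_ne _ _ hab.symm,
    one_mul, mul_one]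

theorem det_markedAdj_gTilde {V : Type*} [Fintype V] [DecidableEq V]
    (G : SimpleGraph V) {A B : V} (hAB : A ≠ B) {J : Finset V} (hB : B ∉ J) :
    (markedAdj G J).det = (markedAdj (gTilde G A B) J).det := by
  refine det_eq_of_add_row_col hAB fun i j => ?_
  have h2 : (1 : ZMod 2) + 1 = 0 := rfl
  have := G.adj_comm i B
  have := G.adj_comm A B
  have := G.adj_comm i j
  have := gTilde_adj G A B i j
  simp only [markedAdj, of_apply, Xor] at this ⊢
  grind

theorem det_markedAdj_toggleEdge_gTilde {V : Type*} [Fintype V] [DecidableEq V]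
    (G : SimpleGraph V) {A B : V} (hAB : A ≠ B) {J : Finset V} (hB : B ∈ J) :
    (markedAdj G J).det =
      (markedAdj (toggleEdge (gTilde G A B) A B) (symmDiff J {A})).det := by
  refine det_eq_of_add_row_col hAB fun i j => ?_
  have h2 : (1 : ZMod 2) + 1 = 0 := rfl
  have := G.adj_comm i B
  have := G.adj_comm A B
  have := G.adj_comm i j
  have := toggleEdge_adj (gTilde G A B) hAB i j
  simp only [markedAdj, of_apply, gTilde_adj, Xor, Finset.mem_symmDiff,
    Finset.mem_singleton] at this ⊢
  grind

theorem neg_one_pow_card_symmDiff_singleton {V R : Type*} [DecidableEq V] [Ring R]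
    (J : Finset V) (a : V) :
    (-1 : R) ^ (symmDiff J {a}).card = -(-1) ^ J.card := by
  by_cases ha : a ∈ J
  · have : symmDiff J {a} = J.erase a := by ext; grind [Finset.mem_symmDiff]
    rw [this, ← Finset.card_erase_add_one ha, pow_succ]
    simp
  · have : symmDiff J {a} = insert a J := by ext; grind [Finset.mem_symmDiff]
    rw [this, Finset.card_insert_of_notMem ha, pow_succ]
    simp

theorem sum_markedAdj_toggleEdge_gTilde {V : Type*} [Fintype V] [DecidableEq V]
    (G : SimpleGraph V) {A B : V} (hAB : A ≠ B) :
    ∑ J : Finset V with B ∈ J, (-1 : ℤ[X]) ^ J.card * X ^ ((markedAdj G J).det).val =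
      -∑ J : Finset V with B ∈ J, (-1 : ℤ[X]) ^ J.card *
        X ^ ((markedAdj (toggleEdge (gTilde G A B) A B) J).det).val := by
  rw [← Finset.sum_neg_distrib]
  refine Finset.sum_nbij' (symmDiff · {A}) (symmDiff · {A}) ?_ ?_ ?_ ?_ ?_
  · simp [Finset.mem_symmDiff, hAB.symm]
  · simp [Finset.mem_symmDiff, hAB.symm]
  · simp
  · simp
  · intro J hJ
    rw [det_markedAdj_toggleEdge_gTilde G hAB (Finset.mem_filter.1 hJ).2,
      neg_one_pow_card_symmDiff_singleton]
    ring

theorem sum_markedAdj_gTilde {V : Type*} [Fintype V] [DecidableEq V]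
    (G : SimpleGraph V) {A B : V} (hAB : A ≠ B) :
    ∑ J : Finset V with B ∉ J, (-1 : ℤ[X]) ^ J.card * X ^ ((markedAdj G J).det).val =
      ∑ J : Finset V with B ∉ J, (-1 : ℤ[X]) ^ J.card *
        X ^ ((markedAdj (gTilde G A B) J).det).val :=
  Finset.sum_congr rfl fun J hJ => by
    rw [det_markedAdj_gTilde G hAB (Finset.mem_filter.1 hJ).2]

/-- `T` satisfies Lando's 4-term relation:
`T(G) − T(G'_{AB}) − T(G̃_{AB}) + T(G̃'_{AB}) = 0`. -/
theorem polyT_four_term {V : Type*} [Fintype V] [DecidableEq V]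
    (G : SimpleGraph V) (A B : V) (hAB : A ≠ B) :
    polyT G - polyT (toggleEdge G A B) - polyT (gTilde G A B)
      + polyT (toggleEdge (gTilde G A B) A B) = 0 := by
  have h₁ := sum_markedAdj_toggleEdge_gTilde G hAB
  have h₂ := sum_markedAdj_toggleEdge_gTilde (toggleEdge G A B) hAB
  have h₃ := sum_markedAdj_gTilde G hAB
  have h₄ := sum_markedAdj_gTilde (toggleEdge G A B) hAB
  rw [gTilde_toggleEdge G hAB] at h₂ h₄
  rw [toggleEdge_toggleEdge _ hAB] at h₂
  simp only [polyT, ← Finset.sum_filter_add_sum_filter_not Finset.univ (B ∈ ·)]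
  linear_combination h₁ - h₂ + h₃ - h₄
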